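/- For every natural number n, T_n(p_c) ≥ (√5 − 1)/2, where p_c := inf{ p ∈ [0,1] : lim_{n→∞} T_n(p) = 1 }. -/

import Mathlib

open Set Filter Topology

noncomputable section

/-- The dyadic tile `[a/2^i, (a+1)/2^i] × [b/2^j, (b+1)/2^j]` as a subset of `ℝ × ℝ`. -/
def dyadicTile (i j a b : ℕ) : Set (ℝ × ℝ) :=
  Set.Icc ((a : ℝ) / 2 ^ i) (((a : ℝ) + 1) / 2 ^ i) ×ˢ
    Set.Icc ((b : ℝ) / 2 ^ j) (((b : ℝ) + 1) / 2 ^ j)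

/-- `t` is a dyadic tile of order `n` contained in the unit square. -/
def IsDyadicTile (n : ℕ) (t : Set (ℝ × ℝ)) : Prop :=
  ∃ i j a b : ℕ, i + j = n ∧ a < 2 ^ i ∧ b < 2 ^ j ∧ t = dyadicTile i j a b

/-- `F` is a tiling of the region `R` by dyadic tiles of order `n`:
a set of order-`n` tiles whose union is `R` and whose interiors are pairwise disjoint. -/
def IsTiling (n : ℕ) (F : Set (Set (ℝ × ℝ))) (R : Set (ℝ × ℝ)) : Prop :=
  (∀ t ∈ F, IsDyadicTile n t) ∧ ⋃₀ F = R ∧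
    F.Pairwise fun s t => interior s ∩ interior t = ∅

def unitSquare : Set (ℝ × ℝ) := Set.Icc (0 : ℝ) 1 ×ˢ Set.Icc (0 : ℝ) 1

/-- Index type for the dyadic tiles of order `n`: a shape `i` (width `2^{-i}`, height
`2^{-(n-i)}`) together with the horizontal and vertical positions. -/
abbrev TileIndex (n : ℕ) : Type :=
  Σ i : Fin (n + 1), Fin (2 ^ (i : ℕ)) × Fin (2 ^ (n - (i : ℕ)))

/-- The order-`n` tile corresponding to an index. -/
def tileOf (n : ℕ) (x : TileIndex n) : Set (ℝ × ℝ) :=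
  dyadicTile (x.1 : ℕ) (n - (x.1 : ℕ)) (x.2.1 : ℕ) (x.2.2 : ℕ)

/-- The set `S` of available order-`n` tiles admits a tiling of the unit square. -/
def TileableSquare (n : ℕ) (S : Finset (TileIndex n)) : Prop :=
  ∃ F : Set (Set (ℝ × ℝ)), (∀ t ∈ F, ∃ x ∈ S, t = tileOf n x) ∧ IsTiling n F unitSquare

open Classical in
/-- Probability of the event `E` when each of the `(n+1)·2^n` order-`n` dyadic tiles is
available independently with probability `p`. -/
def Pr (n : ℕ) (p : ℝ) (E : Finset (TileIndex n) → Prop) : ℝ :=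
  ∑ S : Finset (TileIndex n),
    if E S then p ^ S.card * (1 - p) ^ ((n + 1) * 2 ^ n - S.card) else 0

/-- `T n p`: the probability that some set of available order-`n` tiles tiles `[0,1]²`. -/
def T (n : ℕ) (p : ℝ) : ℝ := Pr n p (TileableSquare n)

/-- The critical probability `p_c`. -/
def pc : ℝ :=
  sInf {p : ℝ | p ∈ Set.Icc (0 : ℝ) 1 ∧ Tendsto (fun n => T n p) atTop (𝓝 1)}


section BernoulliSubsets

variable {α β γ : Type*} [Fintype α] [Fintype β] [Fintype γ]

open Classical in
/-- Probability of the subset `S` when each element is kept independently with probability `p`. -/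
def bernoulliWeight (p : ℝ) (S : Finset α) : ℝ := ∏ a : α, if a ∈ S then p else 1 - p

/-- Expectation of `f` under the Bernoulli measure on subsets. -/
def bernoulliMean (p : ℝ) (f : Finset α → ℝ) : ℝ := ∑ S : Finset α, bernoulliWeight p S * f S

open Classical in
/-- Preimage of a finite set in a finite type. -/
def pullback (φ : β → α) (S : Finset α) : Finset β := Finset.univ.filter fun b => φ b ∈ S

@[simp]
theorem mem_pullback {α β : Type*} [Fintype β] {φ : β → α} {S : Finset α} {b : β} :
    b ∈ pullback φ S ↔ φ b ∈ S := by
  simp [pullback]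

theorem pullback_mono {α β : Type*} [Fintype β] (φ : β → α) : Monotone (pullback φ) :=
  fun _ _ h _ hb => mem_pullback.2 (h (mem_pullback.1 hb))

theorem bernoulliWeight_eq (p : ℝ) (S : Finset α) :
    bernoulliWeight p S = p ^ S.card * (1 - p) ^ (Fintype.card α - S.card) := by
  classical
  rw [bernoulliWeight, Finset.prod_ite, Finset.prod_const, Finset.prod_const,
    Finset.filter_not, Finset.card_sdiff]
  simp

theorem bernoulliWeight_nonneg {p : ℝ} (hp : p ∈ Set.Icc (0 : ℝ) 1) (S : Finset α) :
    0 ≤ bernoulliWeight p S :=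
  Finset.prod_nonneg fun a _ => by
    have := hp.1
    have := hp.2
    split_ifs <;> linarith

theorem bernoulliMean_one (p : ℝ) : bernoulliMean p (fun _ : Finset α => (1 : ℝ)) = 1 := by
  simp only [bernoulliMean, mul_one, bernoulliWeight_eq]
  rw [Fintype.sum_pow_mul_eq_add_pow]
  simp

theorem bernoulliMean_nonneg {p : ℝ} (hp : p ∈ Set.Icc (0 : ℝ) 1) {f : Finset α → ℝ}
    (hf : 0 ≤ f) : 0 ≤ bernoulliMean p f :=
  Finset.sum_nonneg fun S _ => mul_nonneg (bernoulliWeight_nonneg hp S) (hf S)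

theorem bernoulliMean_mono {p : ℝ} (hp : p ∈ Set.Icc (0 : ℝ) 1) {f g : Finset α → ℝ}
    (h : f ≤ g) : bernoulliMean p f ≤ bernoulliMean p g :=
  Finset.sum_le_sum fun S _ => mul_le_mul_of_nonneg_left (h S) (bernoulliWeight_nonneg hp S)

theorem bernoulliMean_equiv (p : ℝ) (e : β ≃ α) (f : Finset α → ℝ) :
    bernoulliMean p (fun S : Finset β => f (S.map e.toEmbedding)) = bernoulliMean p f := by
  refine Fintype.sum_equiv e.finsetCongr _ _ fun S => ?_
  simp [bernoulliWeight_eq, Fintype.card_congr e]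

theorem bernoulliWeight_sum (p : ℝ) (S : Finset (α ⊕ β)) :
    bernoulliWeight p S = bernoulliWeight p S.toLeft * bernoulliWeight p S.toRight := by
  rw [bernoulliWeight, Fintype.prod_sum_type]
  congr 1 <;> refine Finset.prod_congr rfl fun _ _ => ?_ <;> congr 1 <;> simp

theorem bernoulliMean_sum (p : ℝ) (f : Finset α → ℝ) (g : Finset β → ℝ) :
    bernoulliMean p (fun S : Finset (α ⊕ β) => f S.toLeft * g S.toRight) =
      bernoulliMean p f * bernoulliMean p g := by
  simp only [bernoulliMean]
  rw [Finset.sum_mul_sum, ← Finset.sum_product', Finset.univ_product_univ]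
  refine Fintype.sum_equiv Finset.sumEquiv.toEquiv _ _ fun S => ?_
  change bernoulliWeight p S * (f S.toLeft * g S.toRight) =
    bernoulliWeight p S.toLeft * f S.toLeft * (bernoulliWeight p S.toRight * g S.toRight)
  rw [bernoulliWeight_sum]
  exact mul_mul_mul_comm _ _ _ _

/-- The traces of a Bernoulli subset on disjoint parts of the ground set are independent
Bernoulli subsets. -/
theorem bernoulliMean_pullback_mul (p : ℝ) {φ : β → α} {ψ : γ → α}
    (h : Function.Injective (Sum.elim φ ψ)) (f : Finset β → ℝ) (g : Finset γ → ℝ) :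
    bernoulliMean p (fun S => f (pullback φ S) * g (pullback ψ S)) =
      bernoulliMean p f * bernoulliMean p g := by
  classical
  let e : (β ⊕ γ) ⊕ ((range (Sum.elim φ ψ))ᶜ : Set α) ≃ α :=
    (Equiv.sumCongr (Equiv.ofInjective _ h) (Equiv.refl _)).trans (Equiv.Set.sumCompl _)
  have he : ∀ x, e (Sum.inl x) = Sum.elim φ ψ x := fun x => by simp [e]
  have h₁ : ∀ S : Finset ((β ⊕ γ) ⊕ ((range (Sum.elim φ ψ))ᶜ : Set α)),
      pullback φ (S.map e.toEmbedding) = S.toLeft.toLeft := fun S => by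
    ext b
    have : φ b = e (Sum.inl (Sum.inl b)) := by simp [he]
    simp [this]
  have h₂ : ∀ S : Finset ((β ⊕ γ) ⊕ ((range (Sum.elim φ ψ))ᶜ : Set α)),
      pullback ψ (S.map e.toEmbedding) = S.toLeft.toRight := fun S => by
    ext b
    have : ψ b = e (Sum.inl (Sum.inr b)) := by simp [he]
    simp [this]
  rw [← bernoulliMean_equiv p e]
  simp only [h₁, h₂]
  have := bernoulliMean_sum p (fun S : Finset (β ⊕ γ) => f S.toLeft * g S.toRight)
    (fun _ : Finset ((range (Sum.elim φ ψ))ᶜ : Set α) => (1 : ℝ))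
  simpa only [bernoulliMean_one, mul_one, bernoulliMean_sum] using this

/-- Harris' inequality. -/
theorem bernoulliMean_mul_le {p : ℝ} (hp : p ∈ Set.Icc (0 : ℝ) 1) {f g : Finset α → ℝ}
    (hf₀ : 0 ≤ f) (hg₀ : 0 ≤ g) (hf : Monotone f) (hg : Monotone g) :
    bernoulliMean p f * bernoulliMean p g ≤ bernoulliMean p (fun S => f S * g S) := by
  classical
  have h := fkg f g (bernoulliWeight p) (fun S => bernoulliWeight_nonneg hp S) hf₀ hg₀ hf hg
    fun S S' => le_of_eq ?_
  · have h₁ : ∑ S : Finset α, bernoulliWeight p S = 1 := by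
      simpa [bernoulliMean] using bernoulliMean_one (α := α) p
    rwa [h₁, one_mul] at h
  · simp only [bernoulliWeight, ← Finset.prod_mul_distrib]
    refine Finset.prod_congr rfl fun a _ => ?_
    by_cases h₁ : a ∈ S <;> by_cases h₂ : a ∈ S' <;> simp [h₁, h₂, mul_comm]

end BernoulliSubsets

section Geometry

variable {n : ℕ}

theorem TileIndex.ext_val {x y : TileIndex n} (hi : (x.1 : ℕ) = y.1)
    (ha : (x.2.1 : ℕ) = y.2.1) (hb : (x.2.2 : ℕ) = y.2.2) : x = y := by
  obtain ⟨⟨i, hi'⟩, ⟨a, ha'⟩, ⟨b, hb'⟩⟩ := x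
  obtain ⟨⟨j, hj'⟩, ⟨c, hc'⟩, ⟨d, hd'⟩⟩ := y
  simp only at hi ha hb
  subst hi ha hb
  rfl

theorem isDyadicTile_tileOf (x : TileIndex n) : IsDyadicTile n (tileOf n x) :=
  ⟨x.1, n - x.1, x.2.1, x.2.2, by have := x.1.2; omega, x.2.1.2, x.2.2.2, rfl⟩

theorem interior_dyadicTile (i j a b : ℕ) : interior (dyadicTile i j a b) =
    Set.Ioo ((a : ℝ) / 2 ^ i) (((a : ℝ) + 1) / 2 ^ i) ×ˢ
      Set.Ioo ((b : ℝ) / 2 ^ j) (((b : ℝ) + 1) / 2 ^ j) := by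
  rw [dyadicTile, interior_prod_eq, interior_Icc, interior_Icc]

theorem tileOf_subset_unitSquare (x : TileIndex n) : tileOf n x ⊆ unitSquare := by
  have key : ∀ i a : ℕ, a < 2 ^ i →
      Set.Icc ((a : ℝ) / 2 ^ i) (((a : ℝ) + 1) / 2 ^ i) ⊆ Set.Icc 0 1 := fun i a h => by
    refine Set.Icc_subset_Icc (by positivity) ?_
    rw [div_le_one (by positivity)]
    exact_mod_cast h
  exact Set.prod_mono (key _ _ x.2.1.2) (key _ _ x.2.2.2)

theorem isClosed_tileOf (x : TileIndex n) : IsClosed (tileOf n x) :=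
  isClosed_Icc.prod isClosed_Icc

theorem TileableSquare.mono {S S' : Finset (TileIndex n)} (h : TileableSquare n S)
    (hS : S ⊆ S') : TileableSquare n S' := by
  obtain ⟨F, hF, ht⟩ := h
  exact ⟨F, fun t ht => (hF t ht).imp fun _ hx => ⟨hS hx.1, hx.2⟩, ht⟩

theorem exists_lt_mem_Icc_div (m : ℕ) (hm : 0 < m) {u : ℝ} (hu : u ∈ Set.Icc (0 : ℝ) 1) :
    ∃ a < m, u ∈ Set.Icc ((a : ℝ) / m) (((a : ℝ) + 1) / m) := by
  have hm' : (0 : ℝ) < m := by exact_mod_cast hm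
  rcases eq_or_lt_of_le hu.2 with rfl | h
  · refine ⟨m - 1, by omega, ?_⟩
    rw [Nat.cast_sub hm]
    simp [div_le_one hm', hm'.ne']
  · have h₀ : 0 ≤ u * m := mul_nonneg hu.1 hm'.le
    refine ⟨⌊u * m⌋₊, (Nat.floor_lt h₀).2 (by nlinarith), ?_, ?_⟩
    · rw [div_le_iff₀ hm']
      exact Nat.floor_le h₀
    · rw [le_div_iff₀ hm']
      exact (Nat.lt_floor_add_one _).le

theorem tileableSquare_univ (n : ℕ) : TileableSquare n Finset.univ := by
  let col (a : Fin (2 ^ n)) : TileIndex n := ⟨Fin.last n, a, ⟨0, by positivity⟩⟩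
  have hcol : ∀ a, tileOf n (col a) = dyadicTile n 0 a 0 := fun a => by
    simp [tileOf, col]
  refine ⟨Set.range fun a => tileOf n (col a), ?_, ?_, ?_, ?_⟩
  · rintro _ ⟨a, rfl⟩
    exact ⟨_, Finset.mem_univ _, rfl⟩
  · rintro _ ⟨a, rfl⟩
    exact isDyadicTile_tileOf _
  · refine Set.Subset.antisymm ?_ fun q hq => ?_
    · rintro q ⟨_, ⟨a, rfl⟩, hq⟩
      exact tileOf_subset_unitSquare _ hq
    · obtain ⟨a, ha, hqa⟩ := exists_lt_mem_Icc_div (2 ^ n) (by positivity) hq.1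
      refine ⟨_, ⟨⟨a, ha⟩, rfl⟩, ?_⟩
      simp only [hcol, dyadicTile]
      refine ⟨by simpa using hqa, by simpa using hq.2⟩
  · rintro _ ⟨a, rfl⟩ _ ⟨b, rfl⟩ hab
    simp only [hcol, interior_dyadicTile] at hab ⊢
    refine Set.eq_empty_of_forall_notMem fun q ⟨ha, hb⟩ => hab ?_
    have ha := ha.1
    have hb := hb.1
    have hP : (0 : ℝ) < 2 ^ n := by positivity
    simp only [Set.mem_Ioo, div_lt_iff₀ hP, lt_div_iff₀ hP] at ha hb
    have h₁ : ((a : ℕ) : ℝ) < (b : ℕ) + 1 := by linarith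
    have h₂ : ((b : ℕ) : ℝ) < (a : ℕ) + 1 := by linarith
    have : (a : ℕ) = b := by
      have h₁ : (a : ℕ) < b + 1 := by exact_mod_cast h₁
      have h₂ : (b : ℕ) < a + 1 := by exact_mod_cast h₂
      omega
    rw [this]

/-- The order-`n + 1` tile in the left (`c = 0`) or right (`c = 1`) half of the unit square
corresponding to an order-`n` tile. -/
def horizHalf (c : Fin 2) (x : TileIndex n) : TileIndex (n + 1) :=
  ⟨x.1.succ, ⟨x.2.1 + c * 2 ^ (x.1 : ℕ), by
    have := x.2.1.2
    have := Nat.mul_le_mul_right (2 ^ (x.1 : ℕ)) (Nat.le_of_lt_succ c.2)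
    rw [Fin.val_succ, pow_succ]
    omega⟩, ⟨x.2.2, by simp⟩⟩

/-- The order-`n + 1` tile in the lower (`c = 0`) or upper (`c = 1`) half of the unit square
corresponding to an order-`n` tile. -/
def vertHalf (c : Fin 2) (x : TileIndex n) : TileIndex (n + 1) :=
  ⟨x.1.castSucc, ⟨x.2.1, x.2.1.2⟩, ⟨x.2.2 + c * 2 ^ (n - (x.1 : ℕ)), by
    have := x.2.2.2
    have := Nat.mul_le_mul_right (2 ^ (n - (x.1 : ℕ))) (Nat.le_of_lt_succ c.2)
    rw [Fin.val_castSucc, Nat.succ_sub (Nat.le_of_lt_succ x.1.2), pow_succ]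
    omega⟩⟩

/-- Affine map of the line taking `[0, 1]` to its half `[c / 2, (c + 1) / 2]`. -/
def halfHomeomorph (c : ℝ) : ℝ ≃ₜ ℝ where
  toFun u := (u + c) / 2
  invFun u := 2 * u - c
  left_inv u := by ring
  right_inv u := by ring

theorem halfHomeomorph_apply (c u : ℝ) : halfHomeomorph c u = (u + c) / 2 := rfl

theorem halfHomeomorph_mem_Icc {c : ℕ} {i a : ℕ} {u : ℝ} :
    halfHomeomorph c u ∈ Set.Icc (((a + c * 2 ^ i : ℕ) : ℝ) / 2 ^ (i + 1))
        ((((a + c * 2 ^ i : ℕ) : ℝ) + 1) / 2 ^ (i + 1)) ↔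
      u ∈ Set.Icc ((a : ℝ) / 2 ^ i) (((a : ℝ) + 1) / 2 ^ i) := by
  have hP : (0 : ℝ) < 2 ^ i := by positivity
  have hQ : (0 : ℝ) < 2 ^ i * 2 := by positivity
  simp only [halfHomeomorph_apply, Set.mem_Icc, pow_succ,
    div_le_iff₀ hP, le_div_iff₀ hP, div_le_iff₀ hQ, le_div_iff₀ hQ]
  push_cast
  constructor <;> rintro ⟨h₁, h₂⟩ <;> constructor <;> nlinarith

theorem mul_le_and_lt_of_halfHomeomorph_mem {c : ℕ} {i a : ℕ} {u : ℝ}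
    (hu : u ∈ Set.Ioo (0 : ℝ) 1)
    (h : halfHomeomorph c u ∈ Set.Icc ((a : ℝ) / 2 ^ (i + 1)) (((a : ℝ) + 1) / 2 ^ (i + 1))) :
    c * 2 ^ i ≤ a ∧ a < 2 ^ i + c * 2 ^ i := by
  have hP : (0 : ℝ) < 2 ^ i := by positivity
  have hQ : (0 : ℝ) < 2 ^ i * 2 := by positivity
  simp only [halfHomeomorph_apply, Set.mem_Icc, pow_succ,
    div_le_iff₀ hQ, le_div_iff₀ hQ] at h
  obtain ⟨h₁, h₂⟩ := h
  have h₃ := mul_pos hu.1 hP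
  have h₄ := mul_pos (sub_pos.2 hu.2) hP
  constructor
  · have : ((c * 2 ^ i : ℕ) : ℝ) < (a + 1 : ℕ) := by
      push_cast
      nlinarith
    have : c * 2 ^ i < a + 1 := by exact_mod_cast this
    omega
  · have : (a : ℝ) < (2 ^ i + c * 2 ^ i : ℕ) := by
      push_cast
      nlinarith
    exact_mod_cast this

theorem tileOf_eq_preimage_horizHalf (c : Fin 2) (x : TileIndex n) :
    tileOf n x = ((halfHomeomorph (c : ℕ)).prodCongr (Homeomorph.refl ℝ)) ⁻¹'
      tileOf (n + 1) (horizHalf c x) := by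
  ext q
  simp only [tileOf, dyadicTile, horizHalf, Set.mem_preimage, Set.mem_prod, Fin.val_succ,
    Nat.add_sub_add_right]
  exact and_congr halfHomeomorph_mem_Icc.symm Iff.rfl

theorem tileOf_eq_preimage_vertHalf (c : Fin 2) (x : TileIndex n) :
    tileOf n x = ((Homeomorph.refl ℝ).prodCongr (halfHomeomorph (c : ℕ))) ⁻¹'
      tileOf (n + 1) (vertHalf c x) := by
  ext q
  simp only [tileOf, dyadicTile, vertHalf, Set.mem_preimage, Set.mem_prod, Fin.val_castSucc,
    Nat.succ_sub (Nat.le_of_lt_succ x.1.2), Nat.succ_eq_add_one]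
  exact and_congr Iff.rfl halfHomeomorph_mem_Icc.symm

theorem exists_eq_horizHalf {c : Fin 2} {x : TileIndex (n + 1)} (hx : (x.1 : ℕ) ≠ 0)
    {q : ℝ × ℝ} (hq : q.1 ∈ Set.Ioo (0 : ℝ) 1)
    (h : ((halfHomeomorph (c : ℕ)).prodCongr (Homeomorph.refl ℝ)) q ∈ tileOf (n + 1) x) :
    ∃ y, x = horizHalf c y := by
  obtain ⟨⟨i, hi⟩, ⟨a, ha⟩, ⟨b, hb⟩⟩ := x
  obtain ⟨i, rfl⟩ := Nat.exists_eq_succ_of_ne_zero hx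
  have : c * 2 ^ i ≤ a ∧ a < 2 ^ i + c * 2 ^ i :=
    mul_le_and_lt_of_halfHomeomorph_mem hq h.1
  refine ⟨⟨⟨i, by omega⟩, ⟨a - c * 2 ^ i, by dsimp only; omega⟩, ⟨b, by simpa using hb⟩⟩, ?_⟩
  refine TileIndex.ext_val rfl ?_ rfl
  simp only [horizHalf]
  omega

theorem exists_eq_vertHalf {c : Fin 2} {x : TileIndex (n + 1)} (hx : (x.1 : ℕ) ≠ n + 1)
    {q : ℝ × ℝ} (hq : q.2 ∈ Set.Ioo (0 : ℝ) 1)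
    (h : ((Homeomorph.refl ℝ).prodCongr (halfHomeomorph (c : ℕ))) q ∈ tileOf (n + 1) x) :
    ∃ y, x = vertHalf c y := by
  obtain ⟨⟨i, hi⟩, ⟨a, ha⟩, ⟨b, hb⟩⟩ := x
  have hin : i ≤ n := by simp only at hx; omega
  have h := h.2
  simp only [Nat.succ_sub hin, Nat.succ_eq_add_one] at h
  have := mul_le_and_lt_of_halfHomeomorph_mem hq h
  refine ⟨⟨⟨i, by omega⟩, ⟨a, ha⟩, ⟨b - c * 2 ^ (n - i), by dsimp only; omega⟩⟩, ?_⟩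
  refine TileIndex.ext_val rfl rfl ?_
  simp only [vertHalf]
  omega

/-- A tiling of the unit square restricts to a tiling of the part `g '' unitSquare`, provided
that each tile meeting the interior of this part comes from an order-`n` tile. -/
theorem TileableSquare.of_preimage {S : Finset (TileIndex (n + 1))}
    {F : Set (Set (ℝ × ℝ))} (hFS : ∀ t ∈ F, ∃ x ∈ S, t = tileOf (n + 1) x)
    (hF : IsTiling (n + 1) F unitSquare) (g : ℝ × ℝ ≃ₜ ℝ × ℝ)
    (hg : MapsTo g unitSquare unitSquare) (φ : TileIndex n → TileIndex (n + 1))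
    (hφ : ∀ y, tileOf n y = g ⁻¹' tileOf (n + 1) (φ y))
    (hcov : ∀ x, tileOf (n + 1) x ∈ F → ∀ q ∈ Set.Ioo (0 : ℝ) 1 ×ˢ Set.Ioo (0 : ℝ) 1,
      g q ∈ tileOf (n + 1) x → ∃ y, x = φ y) :
    TileableSquare n (pullback φ S) := by
  set A : Set (TileIndex n) := {y | φ y ∈ S ∧ tileOf (n + 1) (φ y) ∈ F}
  refine ⟨tileOf n '' A, ?_, ?_, Set.Subset.antisymm ?_ ?_, ?_⟩
  · rintro _ ⟨y, hy, rfl⟩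
    exact ⟨y, mem_pullback.2 hy.1, rfl⟩
  · rintro _ ⟨y, -, rfl⟩
    exact isDyadicTile_tileOf y
  · rintro q ⟨_, ⟨y, -, rfl⟩, hq⟩
    exact tileOf_subset_unitSquare y hq
  · have hclosed : IsClosed (⋃₀ (tileOf n '' A)) := by
      rw [Set.sUnion_eq_biUnion]
      refine (Set.toFinite _).isClosed_biUnion ?_
      rintro _ ⟨y, -, rfl⟩
      exact isClosed_tileOf y
    have hdense : unitSquare = closure (Set.Ioo (0 : ℝ) 1 ×ˢ Set.Ioo (0 : ℝ) 1) := by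
      rw [closure_prod_eq, closure_Ioo zero_ne_one, unitSquare]
    rw [hdense]
    refine closure_minimal (fun q hq => ?_) hclosed
    have hgq : g q ∈ ⋃₀ F := hF.2.1 ▸ hg (hdense ▸ subset_closure hq)
    obtain ⟨t, ht, hqt⟩ := hgq
    obtain ⟨x, hxS, rfl⟩ := hFS t ht
    obtain ⟨y, rfl⟩ := hcov x ht q hq hqt
    exact ⟨_, ⟨y, ⟨hxS, ht⟩, rfl⟩, by rwa [hφ]⟩
  · rintro _ ⟨y, hy, rfl⟩ _ ⟨z, hz, rfl⟩ hyz
    have hne : tileOf (n + 1) (φ y) ≠ tileOf (n + 1) (φ z) := fun h => hyz (by rw [hφ, hφ, h])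
    rw [hφ, hφ, ← g.preimage_interior, ← g.preimage_interior, ← Set.preimage_inter,
      hF.2.2 hy.2 hz.2 hne, Set.preimage_empty]

/-- A full-width tile and a full-height tile cannot both occur in a tiling. -/
theorem IsTiling.forall_ne_zero_or_forall_ne {F : Set (Set (ℝ × ℝ))}
    (hF : IsTiling (n + 1) F unitSquare) :
    (∀ x, tileOf (n + 1) x ∈ F → (x.1 : ℕ) ≠ 0) ∨
      ∀ x, tileOf (n + 1) x ∈ F → (x.1 : ℕ) ≠ n + 1 := by
  by_contra! h
  obtain ⟨⟨⟨⟨i, hi⟩, ⟨a, ha⟩, ⟨b, hb⟩⟩, hx, rfl : i = 0⟩,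
    ⟨⟨⟨j, hj⟩, ⟨c, hc⟩, ⟨d, hd⟩⟩, hy, rfl : j = n + 1⟩⟩ := h
  simp only [pow_zero, Nat.lt_one_iff, Nat.sub_self] at ha hd
  subst ha hd
  simp only [tileOf, Nat.sub_self, Nat.sub_zero] at hx hy
  have hP : (2 : ℝ) ≤ 2 ^ (n + 1) := le_self_pow₀ one_le_two (by omega)
  have hP₀ : (0 : ℝ) < 2 ^ (n + 1) := by positivity
  have hne : dyadicTile 0 (n + 1) 0 b ≠ dyadicTile (n + 1) 0 c 0 := fun h => by
    have h₀ : ((0 : ℝ), (b : ℝ) / 2 ^ (n + 1)) ∈ dyadicTile 0 (n + 1) 0 b := by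
      simp [dyadicTile, div_le_div_iff_of_pos_right hP₀]
    have h₁ : ((1 : ℝ), (b : ℝ) / 2 ^ (n + 1)) ∈ dyadicTile 0 (n + 1) 0 b := by
      simp [dyadicTile, div_le_div_iff_of_pos_right hP₀]
    rw [h] at h₀ h₁
    have h₀ := h₀.1.1
    have h₁ := h₁.1.2
    simp only [div_le_iff₀ hP₀, le_div_iff₀ hP₀] at h₀ h₁
    linarith
  have hdisj := hF.2.2 hx hy hne
  simp only [interior_dyadicTile] at hdisj
  have hmem : (((c : ℝ) + 1 / 2) / 2 ^ (n + 1), ((b : ℝ) + 1 / 2) / 2 ^ (n + 1)) ∈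
      (∅ : Set (ℝ × ℝ)) := by
    rw [← hdisj]
    have hb' : (b : ℝ) + 1 ≤ 2 ^ (n + 1) := by exact_mod_cast hb
    have hc' : (c : ℝ) + 1 ≤ 2 ^ (n + 1) := by exact_mod_cast hc
    have hb₀ : (0 : ℝ) ≤ b := b.cast_nonneg
    have hc₀ : (0 : ℝ) ≤ c := c.cast_nonneg
    simp only [Set.mem_inter_iff, Set.mem_prod, Set.mem_Ioo, div_lt_div_iff_of_pos_right hP₀]
    simp only [lt_div_iff₀ hP₀, div_lt_iff₀ hP₀, pow_zero, div_one, Nat.cast_zero]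
    refine ⟨⟨⟨?_, ?_⟩, ?_, ?_⟩, ⟨?_, ?_⟩, ?_, ?_⟩ <;> linarith
  exact hmem

theorem halfHomeomorph_mapsTo (c : Fin 2) :
    MapsTo (halfHomeomorph (c : ℕ)) (Set.Icc 0 1) (Set.Icc 0 1) := fun u hu => by
  have hc : ((c : ℕ) : ℝ) ≤ 1 := by exact_mod_cast Nat.le_of_lt_succ c.2
  have hc₀ : (0 : ℝ) ≤ ((c : ℕ) : ℝ) := Nat.cast_nonneg _
  obtain ⟨h₁, h₂⟩ := hu
  rw [halfHomeomorph_apply]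
  constructor <;> linarith

/-- A dyadic tiling of the unit square splits along a vertical or a horizontal bisector. -/
theorem TileableSquare.split {S : Finset (TileIndex (n + 1))} (h : TileableSquare (n + 1) S) :
    (∀ c : Fin 2, TileableSquare n (pullback (horizHalf c) S)) ∨
      ∀ c : Fin 2, TileableSquare n (pullback (vertHalf c) S) := by
  obtain ⟨F, hFS, hF⟩ := h
  refine hF.forall_ne_zero_or_forall_ne.imp (fun h c => ?_) fun h c => ?_
  · exact .of_preimage hFS hF _ (fun q hq => ⟨halfHomeomorph_mapsTo c hq.1, hq.2⟩) _
      (tileOf_eq_preimage_horizHalf c) fun x hx q hq hqx => exists_eq_horizHalf (h x hx) hq.1 hqx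
  · exact .of_preimage hFS hF _ (fun q hq => ⟨hq.1, halfHomeomorph_mapsTo c hq.2⟩) _
      (tileOf_eq_preimage_vertHalf c) fun x hx q hq hqx => exists_eq_vertHalf (h x hx) hq.2 hqx

theorem horizHalf_injective :
    Function.Injective (Sum.elim (horizHalf (n := n) 0) (horizHalf 1)) := by
  have key : ∀ (c d : Fin 2) (x y : TileIndex n), horizHalf c x = horizHalf d y →
      c = d ∧ x = y := by
    rintro c d ⟨⟨i, hi⟩, ⟨a, ha⟩, ⟨b, hb⟩⟩ ⟨⟨j, hj⟩, ⟨a', ha'⟩, ⟨b', hb'⟩⟩ h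
    have h₁ : i + 1 = j + 1 := congrArg (fun z => (z.1 : ℕ)) h
    have h₂ : a + c * 2 ^ i = a' + d * 2 ^ j := congrArg (fun z => (z.2.1 : ℕ)) h
    have h₃ : b = b' := congrArg (fun z => (z.2.2 : ℕ)) h
    obtain rfl : i = j := by omega
    subst h₃
    simp only at ha ha'
    fin_cases c <;> fin_cases d <;> simp at h₂ ⊢ <;> omega
  exact Function.Injective.sumElim (fun x y h => (key _ _ x y h).2) (fun x y h => (key _ _ x y h).2)
    fun x y h => by simpa using (key _ _ x y h).1

theorem vertHalf_injective :
    Function.Injective (Sum.elim (vertHalf (n := n) 0) (vertHalf 1)) := by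
  have key : ∀ (c d : Fin 2) (x y : TileIndex n), vertHalf c x = vertHalf d y →
      c = d ∧ x = y := by
    rintro c d ⟨⟨i, hi⟩, ⟨a, ha⟩, ⟨b, hb⟩⟩ ⟨⟨j, hj⟩, ⟨a', ha'⟩, ⟨b', hb'⟩⟩ h
    have h₁ : i = j := congrArg (fun z => (z.1 : ℕ)) h
    have h₂ : a = a' := congrArg (fun z => (z.2.1 : ℕ)) h
    have h₃ : b + c * 2 ^ (n - i) = b' + d * 2 ^ (n - j) := congrArg (fun z => (z.2.2 : ℕ)) h
    subst h₁ h₂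
    simp only at hb hb'
    fin_cases c <;> fin_cases d <;> simp at h₃ ⊢ <;> omega
  exact Function.Injective.sumElim (fun x y h => (key _ _ x y h).2) (fun x y h => (key _ _ x y h).2)
    fun x y h => by simpa using (key _ _ x y h).1

end Geometry

section Recursion

open Classical in
/-- Indicator function of tileability. -/
def tileInd (n : ℕ) (S : Finset (TileIndex n)) : ℝ := if TileableSquare n S then 1 else 0

theorem tileInd_nonneg (n : ℕ) : 0 ≤ tileInd n := fun S => by
  simp only [tileInd]
  split_ifs <;> simp

theorem tileInd_le_one {n : ℕ} (S : Finset (TileIndex n)) : tileInd n S ≤ 1 := by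
  simp only [tileInd]
  split_ifs <;> simp

theorem tileInd_mono (n : ℕ) : Monotone (tileInd n) := fun S S' h => by
  simp only [tileInd]
  split_ifs with h₁ h₂ <;> first | simp | exact absurd (h₁.mono h) h₂

theorem card_tileIndex (n : ℕ) : Fintype.card (TileIndex n) = (n + 1) * 2 ^ n := by
  have (i : Fin (n + 1)) : 2 ^ (i : ℕ) * 2 ^ (n - (i : ℕ)) = 2 ^ n := by
    rw [← pow_add, Nat.add_sub_cancel' (Nat.le_of_lt_succ i.2)]
  simp [Fintype.card_sigma, this]

theorem T_eq_bernoulliMean (n : ℕ) (p : ℝ) : T n p = bernoulliMean p (tileInd n) := by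
  simp only [T, Pr, bernoulliMean, bernoulliWeight_eq, tileInd, card_tileIndex, mul_ite, mul_one,
    mul_zero]

theorem T_nonneg (n : ℕ) {p : ℝ} (hp : p ∈ Set.Icc (0 : ℝ) 1) : 0 ≤ T n p :=
  T_eq_bernoulliMean n p ▸ bernoulliMean_nonneg hp (tileInd_nonneg n)

theorem T_one (n : ℕ) : T n 1 = 1 := by
  rw [T_eq_bernoulliMean]
  refine Eq.trans ?_ (bernoulliMean_one (α := TileIndex n) 1)
  refine Finset.sum_congr rfl fun S _ => ?_
  by_cases hS : S = Finset.univ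
  · rw [hS, tileInd, if_pos (tileableSquare_univ n)]
  · have : Fintype.card (TileIndex n) - S.card ≠ 0 :=
      Nat.sub_ne_zero_of_lt ((Finset.card_lt_iff_ne_univ S).2 hS)
    rw [bernoulliWeight_eq, sub_self, zero_pow this, mul_zero, zero_mul, zero_mul]

theorem continuous_T (n : ℕ) : Continuous (T n) := by
  unfold T Pr
  refine continuous_finsetSum _ fun S _ => ?_
  split_ifs <;> fun_prop

theorem T_succ_le (n : ℕ) {p : ℝ} (hp : p ∈ Set.Icc (0 : ℝ) 1) :
    T (n + 1) p ≤ 2 * T n p ^ 2 - T n p ^ 4 := by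
  let f : Finset (TileIndex (n + 1)) → ℝ := fun S =>
    tileInd n (pullback (horizHalf 0) S) * tileInd n (pullback (horizHalf 1) S)
  let g : Finset (TileIndex (n + 1)) → ℝ := fun S =>
    tileInd n (pullback (vertHalf 0) S) * tileInd n (pullback (vertHalf 1) S)
  have mono (φ ψ : TileIndex n → TileIndex (n + 1)) :
      Monotone fun S => tileInd n (pullback φ S) * tileInd n (pullback ψ S) := fun S S' h =>
    mul_le_mul (tileInd_mono n (pullback_mono φ h)) (tileInd_mono n (pullback_mono ψ h))
      (tileInd_nonneg n _) (tileInd_nonneg n _)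
  have hf₀ : 0 ≤ f := fun S => mul_nonneg (tileInd_nonneg n _) (tileInd_nonneg n _)
  have hg₀ : 0 ≤ g := fun S => mul_nonneg (tileInd_nonneg n _) (tileInd_nonneg n _)
  have hf : bernoulliMean p f = T n p ^ 2 := by
    rw [T_eq_bernoulliMean, sq]
    exact bernoulliMean_pullback_mul p horizHalf_injective _ _
  have hg : bernoulliMean p g = T n p ^ 2 := by
    rw [T_eq_bernoulliMean, sq]
    exact bernoulliMean_pullback_mul p vertHalf_injective _ _
  have hle : tileInd (n + 1) ≤ fun S => f S + g S - f S * g S := fun S => by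
    have hf₁ : f S ≤ 1 := mul_le_one₀ (tileInd_le_one _) (tileInd_nonneg n _) (tileInd_le_one _)
    have hg₁ : g S ≤ 1 := mul_le_one₀ (tileInd_le_one _) (tileInd_nonneg n _) (tileInd_le_one _)
    by_cases h : TileableSquare (n + 1) S
    · have hfg : f S = 1 ∨ g S = 1 := h.split.imp
        (fun h => by simp [f, tileInd, h]) fun h => by simp [g, tileInd, h]
      have := tileInd_le_one S
      dsimp only
      rcases hfg with h | h <;> rw [h] <;> linarith
    · have := hg₀ S
      have := hf₀ S
      simp only [tileInd, h, if_false]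
      simp only [Pi.zero_apply] at *
      nlinarith
  have hsplit : bernoulliMean p (fun S => f S + g S - f S * g S) =
      bernoulliMean p f + bernoulliMean p g - bernoulliMean p (fun S => f S * g S) := by
    simp only [bernoulliMean, mul_sub, mul_add, Finset.sum_sub_distrib, Finset.sum_add_distrib]
  calc T (n + 1) p = bernoulliMean p (tileInd (n + 1)) := T_eq_bernoulliMean _ _
    _ ≤ bernoulliMean p f + bernoulliMean p g - bernoulliMean p (fun S => f S * g S) :=
      hsplit ▸ bernoulliMean_mono hp hle
    _ ≤ bernoulliMean p f + bernoulliMean p g - bernoulliMean p f * bernoulliMean p g :=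
      sub_le_sub_left (bernoulliMean_mul_le hp hf₀ hg₀ (mono _ _) (mono _ _)) _
    _ = 2 * T n p ^ 2 - T n p ^ 4 := by
      rw [hf, hg]
      ring

/-- Below the golden ratio, `2x² - x⁴ ≤ x`, so the bound propagates to all larger orders. -/
theorem T_lt_of_le {n m : ℕ} (hnm : n ≤ m) {p : ℝ} (hp : p ∈ Set.Icc (0 : ℝ) 1)
    (h : T n p < (Real.sqrt 5 - 1) / 2) : T m p < (Real.sqrt 5 - 1) / 2 := by
  induction m, hnm using Nat.le_induction with
  | base => exact h
  | succ m _ ih =>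
    refine (T_succ_le m hp).trans_lt (lt_of_le_of_lt ?_ ih)
    have hx := T_nonneg m hp
    set x := T m p
    have h₅ : Real.sqrt 5 ^ 2 = 5 := Real.sq_sqrt (by norm_num)
    have h₆ := Real.sqrt_nonneg 5
    have h₇ : Real.sqrt 5 < 3 := by nlinarith
    have h₁ : 0 ≤ 1 - x - x ^ 2 := by nlinarith
    have h₂ : 0 ≤ 1 - x := by linarith
    have := mul_nonneg (mul_nonneg hx h₂) h₁
    nlinarith

end Recursion

/-- `T_n(p_c) ≥ (√5 - 1)/2` for every `n`. -/
theorem T_at_pc_ge (n : ℕ) : T n pc ≥ (Real.sqrt 5 - 1) / 2 := by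
  by_contra! h
  have hmem := csInf_mem_closure
    (s := {p : ℝ | p ∈ Set.Icc (0 : ℝ) 1 ∧ Tendsto (fun n => T n p) atTop (𝓝 1)})
    ⟨1, by simp, by simp [T_one]⟩ ⟨0, fun p hp => hp.1.1⟩
  obtain ⟨p, hpn, hp, hlim⟩ := mem_closure_iff.1 hmem _
    (isOpen_lt (continuous_T n) continuous_const) h
  have h₁ : (1 : ℝ) ≤ (Real.sqrt 5 - 1) / 2 :=
    le_of_tendsto hlim (eventually_atTop.2 ⟨n, fun m hm => (T_lt_of_le hm hp hpn).le⟩)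
  have h₅ : Real.sqrt 5 ^ 2 = 5 := Real.sq_sqrt (by norm_num)
  nlinarith

end
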